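/- arXiv:1310.3479 — 3 statements merged into one kernel-verified Lean document; each statement's English description precedes it below -/
import Mathlib

section
/- Let A be a commutative ring, X a bounded complex of finitely generated projective A-modules, Y any complex of A-modules, p a prime ideal of A, and n an integer. Then there is a natural isomorphism Hom_{D(Mod A)}(X, Y[n]) ⊗_A A_p ≅ Hom_{D(Mod A_p)}(X_p, Y_p[n]), where X_p and Y_p denote the localized complexes. -/
open CategoryTheory Limits CochainComplex

/-- The `n`-th cohomology of the total Hom complex `Hom_A(X, Y)` of two cochain
complexes of `A`-modules, as an `A`-module. For `X` a bounded complex of projectives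
this computes `Hom_{D(Mod A)}(X, Y[n])`. -/
abbrev homComplexCohomology (A : Type) [CommRing A]
    (X Y : CochainComplex (ModuleCat A) ℤ) (n : ℤ) :=
  LinearMap.ker (HomComplex.δ_hom A X Y n (n + 1)) ⧸
    (Submodule.comap (LinearMap.ker (HomComplex.δ_hom A X Y n (n + 1))).subtype
      (LinearMap.range (HomComplex.δ_hom A X Y (n - 1) n)))

section Localization

variable {R T : Type*} [CommRing R] [CommRing T] [Algebra R T] (S : Submonoid R)

/-- A semilinear map from an `R`-module to a `T`-module that exhibits its target as the
localization of its source at `S`, when `T` is the localization of `R` at `S`. -/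
structure IsSemilinearLocalization {M N : Type*} [AddCommGroup M] [Module R M]
    [AddCommGroup N] [Module T N] (φ : M →ₛₗ[algebraMap R T] N) : Prop where
  surj : ∀ y : N, ∃ x : M, ∃ s ∈ S, φ x = algebraMap R T s • y
  exists_smul_eq_zero : ∀ x : M, φ x = 0 → ∃ s ∈ S, s • x = 0

variable {S}

theorem IsSemilinearLocalization.nonempty_tensorProduct_equiv [IsLocalization S T]
    {M N : Type*} [AddCommGroup M] [Module R M] [AddCommGroup N] [Module T N]
    {φ : M →ₛₗ[algebraMap R T] N} (h : IsSemilinearLocalization S φ) :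
    Nonempty (TensorProduct R M T ≃ₗ[R] RestrictScalars R T N) := by
  let ψ : M →ₗ[R] RestrictScalars R T N :=
    { toFun := fun x => (RestrictScalars.addEquiv R T N).symm (φ x)
      map_add' := by simp
      map_smul' := fun r x => by
        rw [map_smulₛₗ]
        exact (RestrictScalars.addEquiv_symm_map_algebraMap_smul R T N r (φ x)) }
  let : Module T (RestrictScalars R T N) := RestrictScalars.moduleOrig R T N
  have : IsScalarTower R T (RestrictScalars R T N) := RestrictScalars.isScalarTower R T N
  have : IsLocalizedModule S ψ :=
    { map_units := fun s => by
        rw [← (Algebra.lsmul R (A := T) R (RestrictScalars R T N)).commutes]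
        exact (IsLocalization.map_units T s).map _
      surj := fun y => by
        obtain ⟨x, s, hs, hx⟩ := h.surj y
        refine ⟨(x, ⟨s, hs⟩), ?_⟩
        exact hx.symm
      exists_of_eq := fun {x₁ x₂} hx => by
        obtain ⟨s, hs, hz⟩ := h.exists_smul_eq_zero (x₁ - x₂) (by
          rw [map_sub, sub_eq_zero]; exact hx)
        exact ⟨⟨s, hs⟩, by rwa [smul_sub, sub_eq_zero] at hz⟩ }
  exact ⟨(TensorProduct.comm R M T).trans
    ((IsLocalizedModule.isBaseChange S T ψ).equiv.restrictScalars R)⟩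

theorem IsSemilinearLocalization.nonempty_homology_equiv [IsLocalization S T]
    {K₀ K₁ K₂ L₀ L₁ L₂ : Type*}
    [AddCommGroup K₀] [Module R K₀] [AddCommGroup K₁] [Module R K₁]
    [AddCommGroup K₂] [Module R K₂] [AddCommGroup L₀] [Module T L₀]
    [AddCommGroup L₁] [Module T L₁] [AddCommGroup L₂] [Module T L₂]
    {φ₀ : K₀ →ₛₗ[algebraMap R T] L₀} {φ₁ : K₁ →ₛₗ[algebraMap R T] L₁}
    {φ₂ : K₂ →ₛₗ[algebraMap R T] L₂}
    (h₀ : IsSemilinearLocalization S φ₀) (h₁ : IsSemilinearLocalization S φ₁)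
    (h₂ : IsSemilinearLocalization S φ₂)
    (d₀ : K₀ →ₗ[R] K₁) (d₁ : K₁ →ₗ[R] K₂) (e₀ : L₀ →ₗ[T] L₁) (e₁ : L₁ →ₗ[T] L₂)
    (comm₀ : ∀ x, e₀ (φ₀ x) = φ₁ (d₀ x)) (comm₁ : ∀ x, e₁ (φ₁ x) = φ₂ (d₁ x)) :
    Nonempty (TensorProduct R
      (LinearMap.ker d₁ ⧸ (LinearMap.range d₀).comap (LinearMap.ker d₁).subtype) T ≃ₗ[R]
      RestrictScalars R T
        (LinearMap.ker e₁ ⧸ (LinearMap.range e₀).comap (LinearMap.ker e₁).subtype)) := by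
  let κ : LinearMap.ker d₁ →ₛₗ[algebraMap R T] LinearMap.ker e₁ :=
    (φ₁.comp (LinearMap.ker d₁).subtype).codRestrict _ fun x => by
      simp [comm₁]
  have hκ : (LinearMap.range d₀).comap (LinearMap.ker d₁).subtype ≤
      ((LinearMap.range e₀).comap (LinearMap.ker e₁).subtype).comap κ := by
    rintro x ⟨w, hw⟩
    exact ⟨φ₀ w, by rw [comm₀, hw]; rfl⟩
  refine nonempty_tensorProduct_equiv (S := S) (φ := Submodule.mapQ _ _ κ hκ) ⟨?_, ?_⟩
  · intro y
    obtain ⟨⟨y, hy⟩, rfl⟩ := Submodule.mkQ_surjective _ y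
    obtain ⟨x, s, hs, hx⟩ := h₁.surj y
    obtain ⟨t, ht, hz⟩ := h₂.exists_smul_eq_zero (d₁ x) (by
      rw [← comm₁, hx, map_smul, LinearMap.mem_ker.1 hy, smul_zero])
    refine ⟨Submodule.Quotient.mk ⟨t • x, by simpa using hz⟩, t * s, S.mul_mem ht hs, ?_⟩
    rw [Submodule.mkQ_apply, Submodule.mapQ_apply, ← Submodule.Quotient.mk_smul]
    congr 1
    ext
    change φ₁ (t • x) = algebraMap R T (t * s) • y
    rw [map_smulₛₗ, hx, map_mul, mul_smul]
  · intro x hx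
    obtain ⟨⟨x, hxk⟩, rfl⟩ := Submodule.mkQ_surjective _ x
    rw [Submodule.mkQ_apply, Submodule.mapQ_apply, Submodule.Quotient.mk_eq_zero] at hx
    obtain ⟨y, hy : e₀ y = φ₁ x⟩ := hx
    obtain ⟨w, s, hs, hw⟩ := h₀.surj y
    obtain ⟨t, ht, hz⟩ := h₁.exists_smul_eq_zero (s • x - d₀ w) (by
      rw [map_sub, map_smulₛₗ, ← comm₀, hw, map_smul, hy, sub_self])
    refine ⟨t * s, S.mul_mem ht hs, ?_⟩
    rw [Submodule.mkQ_apply, ← Submodule.Quotient.mk_smul, Submodule.Quotient.mk_eq_zero]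
    refine ⟨t • w, ?_⟩
    rw [smul_sub, sub_eq_zero] at hz
    change d₀ (t • w) = (t * s) • x
    rw [map_smul, ← hz, mul_smul]

end Localization

section ExtendScalars

universe u v

variable {R T : Type u} [CommRing R] [CommRing T]

theorem ModuleCat.additive_extendScalars (f : R →+* T) :
    (extendScalars.{u, u, max v u} f).Additive :=
  (extendRestrictScalarsAdj.{v} f).left_adjoint_additive

theorem ModuleCat.extendScalars_map_smul (f : R →+* T) {M N : ModuleCat.{max v u} R} (r : R)
    (g : M ⟶ N) :
    (extendScalars f).map (r • g) = f r • (extendScalars f).map g := by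
  apply ExtendScalars.hom_ext
  intro m
  exact (((extendRestrictScalarsAdj f).unit.app N).hom.map_smul r (g m))

theorem ModuleCat.isLocalizedModule_extendScalars_unit (f : R →+* T) (S : Submonoid R)
    (hf : letI := f.toAlgebra; IsLocalization S T) (M : ModuleCat.{max v u} R) :
    IsLocalizedModule S ((extendRestrictScalarsAdj f).unit.app M).hom := by
  let := f.toAlgebra
  exact (isLocalizedModule_iff_isBaseChange S T (TensorProduct.mk R T M 1)).2
    (TensorProduct.isBaseChange R M T)

theorem ModuleCat.exists_extendScalars_map_eq_smul (f : R →+* T) (S : Submonoid R)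
    (hf : letI := f.toAlgebra; IsLocalization S T) {M N : ModuleCat.{max v u} R}
    [Module.FinitePresentation R M]
    (g : (extendScalars f).obj M ⟶ (extendScalars f).obj N) :
    ∃ h : M ⟶ N, ∃ s ∈ S, (extendScalars f).map h = f s • g := by
  have := isLocalizedModule_extendScalars_unit f S hf N
  have : Module.FinitePresentation R ((𝟭 (ModuleCat R)).obj M) := ‹_›
  obtain ⟨h, s, hs⟩ := Module.FinitePresentation.exists_lift_of_isLocalizedModule S
    ((extendRestrictScalarsAdj f).unit.app N).hom
    (((restrictScalars f).map g).hom ∘ₗ ((extendRestrictScalarsAdj f).unit.app M).hom)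
  exact ⟨ofHom h, s, s.2, ExtendScalars.hom_ext fun m => LinearMap.congr_fun hs m⟩

theorem ModuleCat.exists_smul_eq_zero_of_extendScalars_map_eq_zero (f : R →+* T)
    (S : Submonoid R) (hf : letI := f.toAlgebra; IsLocalization S T) {M N : ModuleCat.{max v u} R}
    [Module.Finite R M] (g : M ⟶ N) (hg : (extendScalars f).map g = 0) :
    ∃ s ∈ S, s • g = 0 := by
  have := isLocalizedModule_extendScalars_unit f S hf N
  obtain ⟨s, hs⟩ := Module.Finite.exists_smul_of_comp_eq_of_isLocalizedModule S
    ((extendRestrictScalarsAdj f).unit.app N).hom g.hom 0 (by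
      rw [LinearMap.comp_zero, ← hom_comp, ← Functor.id_map g,
        (extendRestrictScalarsAdj f).unit.naturality, Functor.comp_map, hg, Functor.map_zero,
        comp_zero, hom_zero])
  refine ⟨s, s.2, ?_⟩
  ext m
  rw [smul_zero] at hs
  exact LinearMap.congr_fun hs m

end ExtendScalars

section Cochain

universe u v

attribute [local instance] ModuleCat.additive_extendScalars

variable {R T : Type u} [CommRing R] [CommRing T] [Algebra R T]
  (X Y : CochainComplex (ModuleCat.{max v u} R) ℤ) (n : ℤ)

/-- Extension of scalars on cochains, as a semilinear map. -/
noncomputable def CochainComplex.HomComplex.Cochain.extendScalarsMap :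
    Cochain X Y n →ₛₗ[algebraMap R T]
      Cochain
        (((ModuleCat.extendScalars (algebraMap R T)).mapHomologicalComplex
          (ComplexShape.up ℤ)).obj X)
        (((ModuleCat.extendScalars (algebraMap R T)).mapHomologicalComplex
          (ComplexShape.up ℤ)).obj Y) n where
  toFun z := z.map (ModuleCat.extendScalars (algebraMap R T))
  map_add' _ _ := Cochain.map_add _ _ _
  map_smul' r z := by
    ext p q hpq : 1
    exact ModuleCat.extendScalars_map_smul (algebraMap R T) r (z.v p q hpq)

theorem CochainComplex.HomComplex.Cochain.isSemilinearLocalization_extendScalarsMap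
    (S : Submonoid R) [IsLocalization S T]
    (hfp : ∀ i, Module.FinitePresentation R (X.X i)) (a b : ℤ)
    (hX : ∀ i : ℤ, (i < a ∨ b < i) → IsZero (X.X i)) :
    IsSemilinearLocalization S (extendScalarsMap (T := T) X Y n) := by
  have hT : letI := (algebraMap R T).toAlgebra; IsLocalization S T := by
    rwa [toAlgebra_algebraMap]
  have hout {i : ℤ} (hi : i ∉ Finset.Icc a b) : IsZero (X.X i) := hX i (by
    rw [Finset.mem_Icc] at hi; lia)
  constructor
  · intro y
    choose h s hs hh using fun i : ℤ =>
      ModuleCat.exists_extendScalars_map_eq_smul (algebraMap R T) S hT (y.v i (i + n) rfl)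
    let t (i : ℤ) : R := ∏ j ∈ (Finset.Icc a b).erase i, s j
    refine ⟨Cochain.mk fun p q hpq => t p • h p ≫ eqToHom (by rw [hpq]),
      ∏ j ∈ Finset.Icc a b, s j, S.prod_mem fun j _ => hs j, ?_⟩
    ext p q rfl : 1
    by_cases hp : p ∈ Finset.Icc a b
    · change (ModuleCat.extendScalars (algebraMap R T)).map (t p • h p ≫ 𝟙 _) =
        algebraMap R T (∏ j ∈ Finset.Icc a b, s j) • y.v p _ rfl
      rw [Category.comp_id, ModuleCat.extendScalars_map_smul, hh,
        ← Finset.prod_erase_mul _ _ hp, map_mul]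
      exact (mul_smul _ _ _).symm
    · exact ((ModuleCat.extendScalars (algebraMap R T)).map_isZero (hout hp)).eq_of_src _ _
  · intro x hx
    choose s hs hh using fun i : ℤ =>
      ModuleCat.exists_smul_eq_zero_of_extendScalars_map_eq_zero (algebraMap R T) S hT
        (x.v i (i + n) rfl) (Cochain.congr_v hx i (i + n) rfl)
    refine ⟨∏ j ∈ Finset.Icc a b, s j, S.prod_mem fun j _ => hs j, ?_⟩
    ext p q rfl : 1
    by_cases hp : p ∈ Finset.Icc a b
    · rw [Cochain.smul_v, ← Finset.prod_erase_mul _ _ hp, mul_smul, hh, smul_zero, Cochain.zero_v]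
    · exact (hout hp).eq_of_src _ _

end Cochain

/-- let `A` be a commutative ring, `X` a bounded complex of finitely
generated projective `A`-modules, `Y` any complex of `A`-modules, `p` a prime ideal and
`n` an integer. Then `Hom_{D(Mod A)}(X, Y[n]) ⊗_A A_p ≅ Hom_{D(Mod A_p)}(X_p, Y_p[n])`,
where both sides are computed as the `n`-th cohomology of the total Hom complexes and
`X_p`, `Y_p` are obtained by applying localization `- ⊗_A A_p` componentwise. -/
theorem stmt2 (A : Type) [CommRing A] (p : Ideal A) [p.IsPrime]
    (X Y : CochainComplex (ModuleCat A) ℤ)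
    (hXproj : ∀ i : ℤ, Projective (X.X i) ∧ Module.Finite A (X.X i))
    (hXbdd : ∃ a b : ℤ, ∀ i : ℤ, (i < a ∨ b < i) → IsZero (X.X i))
    (n : ℤ) :
    Nonempty (
      TensorProduct A (homComplexCohomology A X Y n) (Localization.AtPrime p) ≃ₗ[A]
      RestrictScalars A (Localization.AtPrime p)
        (homComplexCohomology (Localization.AtPrime p)
          (((ModuleCat.extendScalars
              (algebraMap A (Localization.AtPrime p))).mapHomologicalComplex
            (ComplexShape.up ℤ)).obj X)
          (((ModuleCat.extendScalars
              (algebraMap A (Localization.AtPrime p))).mapHomologicalComplex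
            (ComplexShape.up ℤ)).obj Y) n)) := by
  obtain ⟨a, b, hX⟩ := hXbdd
  have hfp (i : ℤ) : Module.FinitePresentation A (X.X i) := by
    have := (hXproj i).2
    have : Module.Projective A (X.X i) := (IsProjective.iff_projective (X.X i)).2 (hXproj i).1
    exact Module.finitePresentation_of_projective A (X.X i)
  have h (m : ℤ) := HomComplex.Cochain.isSemilinearLocalization_extendScalarsMap
    (T := Localization.AtPrime p) X Y m p.primeCompl hfp a b hX
  have := ModuleCat.additive_extendScalars (algebraMap A (Localization.AtPrime p))
  exact IsSemilinearLocalization.nonempty_homology_equiv (h (n - 1)) (h n) (h (n + 1)) _ _ _ _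
    (fun z => HomComplex.δ_map _ _ z (ModuleCat.extendScalars (algebraMap A _)))
    (fun z => HomComplex.δ_map _ _ z (ModuleCat.extendScalars (algebraMap A _)))
end

section
/- Every finitely generated tilting module over a commutative ring is projective. -/
open CategoryTheory Limits

open scoped TensorProduct in
/-- Over a commutative ring, tensoring with a finite faithful module detects vanishing of finite
modules. -/
theorem Module.subsingleton_of_subsingleton_tensorProduct_of_faithful
    {R E T : Type*} [CommRing R] [AddCommGroup E] [Module R E] [AddCommGroup T] [Module R T]
    [Module.Finite R E] [Module.Finite R T] (hT : Module.annihilator R T = ⊥)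
    (h : Subsingleton (E ⊗[R] T)) : Subsingleton E := by
  by_contra hE
  rw [not_subsingleton_iff_nontrivial] at hE
  obtain ⟨N, hN, -⟩ := (eq_top_or_exists_le_coatom (⊥ : Submodule R E)).resolve_left bot_ne_top
  have : IsSimpleModule R (E ⧸ N) := isSimpleModule_iff_isCoatom.mpr hN
  obtain ⟨I, hI, ⟨e⟩⟩ := isSimpleModule_iff_quot_maximal.mp this
  have hs : Subsingleton ((R ⧸ I) ⊗[R] T) :=
    (LinearMap.rTensor_surjective T (g := e.toLinearMap ∘ₗ N.mkQ)
      (e.surjective.comp N.mkQ_surjective)).subsingleton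
  have hIT : Subsingleton (T ⧸ (I • ⊤ : Submodule R T)) :=
    (TensorProduct.quotTensorEquivQuotSMul T I).symm.toEquiv.subsingleton
  rw [Submodule.Quotient.subsingleton_iff] at hIT
  obtain ⟨r, hr, hr0⟩ := Submodule.exists_sub_one_mem_and_smul_eq_zero_of_fg_of_le_smul I
    (⊤ : Submodule R T) Module.Finite.fg_top hIT.ge
  have hr1 : r ∈ Module.annihilator R T := Module.mem_annihilator.mpr fun t => hr0 t trivial
  rw [hT, Submodule.mem_bot] at hr1
  subst hr1
  exact hI.ne_top ((Ideal.eq_top_iff_one I).mpr (by simpa using I.neg_mem hr))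

open scoped TensorProduct in
/-- Let `j : K → P` be a map of finite projective modules such that every map from `K` to a
finite faithful module `T` extends along `j`. Then every linear form on `K` extends along `j`. -/
theorem LinearMap.dualMap_surjective_of_extends
    {R K P T : Type*} [CommRing R] [AddCommGroup K] [Module R K] [AddCommGroup P] [Module R P]
    [AddCommGroup T] [Module R T] [Module.Finite R K] [Module.Projective R K]
    [Module.Finite R P] [Module.Projective R P] [Module.Finite R T]
    (hT : Module.annihilator R T = ⊥) (j : K →ₗ[R] P)
    (hj : ∀ g : K →ₗ[R] T, ∃ h : P →ₗ[R] T, h ∘ₗ j = g) :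
    Function.Surjective j.dualMap := by
  have hsurj : Function.Surjective (j.dualMap.rTensor T) := by
    intro x
    obtain ⟨h, hh⟩ := hj (dualTensorHom R K T x)
    obtain ⟨y, rfl⟩ := (dualTensorHom_bijective (R := R) (M := P) (N := T)).2 h
    refine ⟨y, (dualTensorHom_bijective (R := R) (M := K) (N := T)).1 ?_⟩
    rw [← hh]
    exact LinearMap.congr_fun (dualTensorHom_comp_rTensor_dualMap (N := P) (P := T) j) y
  have hs : Subsingleton ((Module.Dual R K ⧸ LinearMap.range j.dualMap) ⊗[R] T) := by
    have hex := rTensor_exact T (LinearMap.exact_map_mkQ_range j.dualMap)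
      (Submodule.mkQ_surjective _)
    have hq := LinearMap.rTensor_surjective T (Submodule.mkQ_surjective (LinearMap.range j.dualMap))
    refine subsingleton_of_forall_eq 0 fun x => ?_
    obtain ⟨y, rfl⟩ := hq x
    exact (hex y).mpr (hsurj y)
  have := Module.subsingleton_of_subsingleton_tensorProduct_of_faithful hT hs
  rw [Submodule.Quotient.subsingleton_iff] at this
  exact LinearMap.range_eq_top.mp this

/-- A map of modules into `P` with finite projective source `K` splits as soon as every linear
form on `K` extends to `P`. -/
theorem LinearMap.exists_leftInverse_of_dualMap_surjective
    {R K P : Type*} [CommRing R] [AddCommGroup K] [Module R K] [AddCommGroup P] [Module R P]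
    [Module.Finite R K] [Module.Projective R K] (j : K →ₗ[R] P)
    (hj : Function.Surjective j.dualMap) : ∃ s : P →ₗ[R] K, s ∘ₗ j = LinearMap.id := by
  obtain ⟨x, hx⟩ := (dualTensorHom_bijective (R := R) (M := K) (N := K)).2 LinearMap.id
  obtain ⟨y, rfl⟩ := LinearMap.rTensor_surjective K hj x
  refine ⟨dualTensorHom R P K y, ?_⟩
  rw [← hx]
  exact LinearMap.congr_fun (dualTensorHom_comp_rTensor_dualMap (N := P) (P := K) j).symm y

/-- The cokernel of a split monomorphism into a projective module is projective. -/
theorem Module.Projective.of_exact_of_leftInverse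
    {R K P Q : Type*} [Ring R] [AddCommGroup K] [Module R K] [AddCommGroup P] [Module R P]
    [AddCommGroup Q] [Module R Q] [Module.Projective R P] {j : K →ₗ[R] P} {q : P →ₗ[R] Q}
    (hex : Function.Exact j q) (hq : Function.Surjective q) (s : P →ₗ[R] K)
    (hs : s ∘ₗ j = LinearMap.id) : Module.Projective R Q := by
  obtain ⟨t, ht⟩ := (((Function.Exact.split_tfae' hex).out 1 0 rfl rfl).mp ⟨hq, s, hs⟩).2
  exact Module.Projective.of_split t q ht

/-- An exact sequence of projective objects augmented by an epimorphism onto `Z` is a projective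
resolution of `Z`. -/
noncomputable def CategoryTheory.ProjectiveResolution.ofExact {C : Type*} [Category* C] [Abelian C]
    {Z : C} (P : ℕ → C) [∀ i, Projective (P i)] (d : ∀ i, P (i + 1) ⟶ P i) (ε : P 0 ⟶ Z) [Epi ε]
    (sq : ∀ i, d (i + 1) ≫ d i = 0) (w : d 0 ≫ ε = 0)
    (h₀ : (ShortComplex.mk _ _ w).Exact) (h : ∀ i, (ShortComplex.mk _ _ (sq i)).Exact) :
    ProjectiveResolution Z where
  complex := ChainComplex.of P d sq
  projective := fun i => inferInstanceAs (Projective (P i))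
  π := (ChainComplex.toSingle₀Equiv _ _).symm ⟨ε, by
    change ChainComplex.of.d P d (0 + 1) 0 ≫ ε = 0
    rw [ChainComplex.of_d, w]⟩
  quasiIso := ⟨fun n => by
    cases n with
    | zero =>
      rw [ChainComplex.quasiIsoAt₀_iff, ShortComplex.quasiIso_iff_of_zeros']
      · dsimp
        refine (ShortComplex.exact_and_epi_g_iff_of_iso ?_).2 ⟨h₀, by dsimp; infer_instance⟩
        exact ShortComplex.isoMk (Iso.refl _) (Iso.refl _) (Iso.refl _)
          ((Category.id_comp _).trans <| (ChainComplex.of_d P d 0).symm.trans (Category.comp_id _).symm)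
          ((Category.id_comp _).trans <|
            (ChainComplex.toSingle₀Equiv_symm_apply_f_zero (C := .of P d sq) (X := Z) ε _).symm.trans
              (Category.comp_id _).symm)
      all_goals rfl
    | succ n =>
      rw [quasiIsoAt_iff_exactAt']
      · rw [HomologicalComplex.exactAt_iff' _ (n + 1 + 1) (n + 1) n (by simp) (by simp)]
        refine (ShortComplex.exact_iff_of_iso ?_).2 (h n)
        exact ShortComplex.isoMk (Iso.refl _) (Iso.refl _) (Iso.refl _)
          ((Category.id_comp _).trans <| (ChainComplex.of_d P d (n + 1)).symm.trans (Category.comp_id _).symm)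
          ((Category.id_comp _).trans <| (ChainComplex.of_d P d n).symm.trans (Category.comp_id _).symm)
      · apply ChainComplex.exactAt_succ_single_obj⟩

/-- If `Ext (n + 1) X Y` vanishes, then `(n + 1)`-cocycles with values in `Y` on a projective
resolution of `X` are coboundaries. -/
theorem CategoryTheory.ProjectiveResolution.exists_d_comp_eq_of_isZero_Ext
    {R C : Type*} [Ring R] [Category* C] [Abelian C] [Linear R C] [EnoughProjectives C]
    {X Y : C} (P : ProjectiveResolution X) (n : ℕ)
    (hn : IsZero (((Ext R C (n + 1)).obj (Opposite.op X)).obj Y))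
    (g : P.complex.X (n + 1) ⟶ Y) (hg : P.complex.d (n + 2) (n + 1) ≫ g = 0) :
    ∃ h : P.complex.X n ⟶ Y, P.complex.d (n + 1) n ≫ h = g := by
  have hz := hn.of_iso (P.isoExt (R := R) (n + 1) Y).symm
  rw [← HomologicalComplex.exactAt_iff_isZero_homology,
    HomologicalComplex.exactAt_iff' _ n (n + 1) (n + 2) (by simp) (by simp),
    ShortComplex.moduleCat_exact_iff] at hz
  exact hz g hg

/-- every finitely generated tilting module over a commutative ring is
projective. Here `T` is tilting if: (i) it admits a finite resolution by finitely
generated projectives; (ii) `Ext^i_R(T, T^{(ι)}) = 0` for all `i > 0` and all index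
sets `ι`; (iii) there is an exact sequence `0 → R → T₀ → ⋯ → T_n → 0` with each `T_i`
in `add T`. -/
theorem stmt6 (R T : Type) [CommRing R] [AddCommGroup T] [Module R T]
    -- (i) a finite resolution by finitely generated projectives
    (hres : ∃ (N : ℕ) (Ps : ℕ → ModuleCat R) (d : ∀ i : ℕ, Ps (i + 1) ⟶ Ps i)
      (ε : Ps 0 ⟶ ModuleCat.of R T),
      (∀ i, Projective (Ps i) ∧ Module.Finite R (Ps i)) ∧
      Function.Surjective ε ∧ Function.Exact (d 0) ε ∧
      (∀ i, Function.Exact (d (i + 1)) (d i)) ∧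
      ∀ i, N < i → Subsingleton (Ps i))
    -- (ii) vanishing of self-extensions against arbitrary direct sums of copies of T
    (hext : ∀ (i : ℕ), 0 < i → ∀ (ι : Type),
      IsZero (((Ext R (ModuleCat R) i).obj
        (Opposite.op (ModuleCat.of R T))).obj (ModuleCat.of R (ι →₀ T))))
    -- (iii) a finite coresolution 0 → R → T₀ → ⋯ → T_n → 0 with terms in add T
    (hcores : ∃ (n : ℕ) (Ts : ℕ → ModuleCat R) (f : ModuleCat.of R R ⟶ Ts 0)
      (d : ∀ i : ℕ, Ts i ⟶ Ts (i + 1)),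
      Function.Injective f ∧ Function.Exact f (d 0) ∧
      (∀ i, Function.Exact (d i) (d (i + 1))) ∧
      (∀ i, n < i → Subsingleton (Ts i)) ∧
      (∀ i, i ≤ n → ∃ (m : ℕ) (u : Ts i →ₗ[R] (Fin m → T)) (v : (Fin m → T) →ₗ[R] Ts i),
        v.comp u = LinearMap.id)) :
    Module.Projective R T := by
  have hfaith : Module.annihilator R T = ⊥ := by
    obtain ⟨n, Ts, f, -, hf, -, -, -, hadd⟩ := hcores
    obtain ⟨m, u, v, huv⟩ := hadd 0 n.zero_le
    rw [eq_bot_iff]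
    intro r hr
    rw [Module.mem_annihilator] at hr
    have hu : u (f.hom r) = 0 := by
      have : f.hom r = r • f.hom (1 : R) := by rw [← map_smul, smul_eq_mul, mul_one]
      rw [this, map_smul]
      exact funext fun i => hr _
    have hfr : f.hom r = 0 := by simpa [hu] using (LinearMap.congr_fun huv (f.hom r)).symm
    exact hf (hfr.trans (map_zero f.hom).symm)
  obtain ⟨N, Ps, d, ε, hP, hε, hdε, hd, hN⟩ := hres
  have hproj (i : ℕ) : Projective (Ps i) := (hP i).1
  have hproj' (i : ℕ) : Module.Projective R (Ps i) :=
    (IsProjective.iff_projective (Ps i)).mpr (hP i).1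
  have hfin (i : ℕ) : Module.Finite R (Ps i) := (hP i).2
  have hfinT : Module.Finite R T := Module.Finite.of_surjective ε.hom hε
  have : Epi ε := (ModuleCat.epi_iff_surjective ε).mpr hε
  have sq (i : ℕ) : d (i + 1) ≫ d i = 0 :=
    ModuleCat.hom_ext (LinearMap.ext fun x => (hd i).apply_apply_eq_zero x)
  have w : d 0 ≫ ε = 0 :=
    ModuleCat.hom_ext (LinearMap.ext fun x => hdε.apply_apply_eq_zero x)
  let P : ProjectiveResolution (ModuleCat.of R T) :=
    .ofExact Ps d ε sq w (ModuleCat.shortComplex_exact _ hdε)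
      fun i => ModuleCat.shortComplex_exact _ (hd i)
  have hcocycle (n : ℕ) (g : Ps (n + 1) →ₗ[R] T) (hg : g ∘ₗ (d (n + 1)).hom = 0) :
      ∃ h : Ps n →ₗ[R] T, h ∘ₗ (d n).hom = g := by
    let e : (Unit →₀ T) ≃ₗ[R] T := Finsupp.uniqueLinearEquiv R T ()
    obtain ⟨h, hh⟩ := P.exists_d_comp_eq_of_isZero_Ext n (hext (n + 1) n.succ_pos Unit)
      (ModuleCat.ofHom (e.symm.toLinearMap ∘ₗ g)) (by
        change ChainComplex.of.d Ps d (n + 1 + 1) (n + 1) ≫ _ = 0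
        rw [ChainComplex.of_d]
        ext1
        change (e.symm.toLinearMap ∘ₗ g) ∘ₗ (d (n + 1)).hom = 0
        rw [LinearMap.comp_assoc, hg, LinearMap.comp_zero])
    change ChainComplex.of.d Ps d (n + 1) n ≫ _ = _ at hh
    rw [ChainComplex.of_d] at hh
    refine ⟨e.toLinearMap ∘ₗ h.hom, LinearMap.ext fun x => ?_⟩
    have := LinearMap.congr_fun (congrArg ModuleCat.Hom.hom hh) x
    exact (congrArg e this).trans (e.apply_symm_apply _)
  have hsplit (n : ℕ) (hK : Module.Projective R (LinearMap.range (d n).hom)) :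
      ∃ s : Ps n →ₗ[R] LinearMap.range (d n).hom,
        s ∘ₗ (LinearMap.range (d n).hom).subtype = LinearMap.id := by
    refine LinearMap.exists_leftInverse_of_dualMap_surjective _
      (LinearMap.dualMap_surjective_of_extends hfaith _ fun g => ?_)
    obtain ⟨h, hh⟩ := hcocycle n (g ∘ₗ (d n).hom.rangeRestrict) <| LinearMap.ext fun x => by
      have : (d n).hom.rangeRestrict ((d (n + 1)).hom x) = 0 :=
        Subtype.ext ((hd n).apply_apply_eq_zero x)
      simp [this]
    refine ⟨h, LinearMap.ext ?_⟩
    rintro ⟨_, x, rfl⟩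
    exact LinearMap.congr_fun hh x
  have hsyz (k n : ℕ) (hk : N ≤ n + k) : Module.Projective R (LinearMap.range (d n).hom) := by
    induction k generalizing n with
    | zero =>
      have := hN (n + 1) (by omega)
      have : Subsingleton (LinearMap.range (d n).hom) :=
        (d n).hom.surjective_rangeRestrict.subsingleton
      infer_instance
    | succ k ih =>
      obtain ⟨s, hs⟩ := hsplit (n + 1) (ih (n + 1) (by omega))
      refine Module.Projective.of_exact_of_leftInverse (q := (d n).hom.rangeRestrict)
        (fun x => ?_) (d n).hom.surjective_rangeRestrict s hs
      rw [Submodule.coe_subtype, Subtype.range_coe]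
      exact Subtype.ext_iff.trans (hd n x)
  obtain ⟨s, hs⟩ := hsplit 0 (hsyz N 0 (by omega))
  refine Module.Projective.of_exact_of_leftInverse (q := ε.hom) (fun x => ?_) hε s hs
  rw [Submodule.coe_subtype, Subtype.range_coe]
  exact hdε x
end

section
/- Given a recollement of D(Mod A) by D(Mod B) and D(Mod C), applying RHom_A(-, i_* i^*(A)) to the canonical triangle j_! j^!(A) → A → i_* i^*(A) → yields an isomorphism i_* i^*(A) ≅ RHom_A(i_* i^*(A), i_* i^*(A)) in the derived category of k-modules. -/
open CategoryTheory Limits Pretriangulated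

/-- A complex representing an object of `K^b(proj R)`: a bounded complex of finitely
generated projective modules. -/
def IsKbProjComplex (R : Type) [Ring R] (Q : CochainComplex (ModuleCat R) ℤ) : Prop :=
  (∀ i : ℤ, Projective (Q.X i) ∧ Module.Finite R (Q.X i)) ∧
  ∃ a b : ℤ, ∀ i : ℤ, (i < a ∨ b < i) → IsZero (Q.X i)

/-- An object of the derived category lies in `K^b(proj R)` (equivalently, is compact)
if it is isomorphic to a bounded complex of finitely generated projectives. -/
def InKbProj (R : Type) [Ring R] [HasDerivedCategory (ModuleCat R)]
    (X : DerivedCategory (ModuleCat R)) : Prop :=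
  ∃ Q : CochainComplex (ModuleCat R) ℤ, IsKbProjComplex R Q ∧
    Nonempty (X ≅ DerivedCategory.Q.obj Q)

/-- The ring `R`, viewed as the stalk complex in degree `0` in its derived category. -/
noncomputable def ringObj (R : Type) [Ring R] [HasDerivedCategory (ModuleCat R)] :
    DerivedCategory (ModuleCat R) :=
  (DerivedCategory.singleFunctor (ModuleCat R) 0).obj (ModuleCat.of R R)

/-- A recollement of `D(Mod A)` by `D(Mod B)` and `D(Mod C)` in the sense of
Beilinson–Bernstein–Deligne: six functors `(i^*, i_* = i_!, i^!, j_!, j^! = j^*, j_*)`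
forming adjoint pairs, with `i_*`, `j_!`, `j_*` fully faithful, `j^* i_* = 0`, and
the two canonical triangles distinguished. -/
structure DRecollement (B A C : Type) [Ring B] [Ring A] [Ring C]
    [HasDerivedCategory (ModuleCat B)] [HasDerivedCategory (ModuleCat A)]
    [HasDerivedCategory (ModuleCat C)] where
  iStar : DerivedCategory (ModuleCat A) ⥤ DerivedCategory (ModuleCat B)
  iS : DerivedCategory (ModuleCat B) ⥤ DerivedCategory (ModuleCat A)
  iShriek : DerivedCategory (ModuleCat A) ⥤ DerivedCategory (ModuleCat B)
  jShriek : DerivedCategory (ModuleCat C) ⥤ DerivedCategory (ModuleCat A)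
  jStar : DerivedCategory (ModuleCat A) ⥤ DerivedCategory (ModuleCat C)
  jS : DerivedCategory (ModuleCat C) ⥤ DerivedCategory (ModuleCat A)
  adj₁ : iStar ⊣ iS
  adj₂ : iS ⊣ iShriek
  adj₃ : jShriek ⊣ jStar
  adj₄ : jStar ⊣ jS
  iS_full : iS.Full
  iS_faithful : iS.Faithful
  jShriek_full : jShriek.Full
  jShriek_faithful : jShriek.Faithful
  jS_full : jS.Full
  jS_faithful : jS.Faithful
  vanish : ∀ X, IsZero (jStar.obj (iS.obj X))
  tri₁ : ∀ X : DerivedCategory (ModuleCat A),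
    ∃ h : iS.obj (iStar.obj X) ⟶ (jShriek.obj (jStar.obj X))⟦(1 : ℤ)⟧,
      Triangle.mk (adj₃.counit.app X) (adj₁.unit.app X) h ∈ distTriang _
  tri₂ : ∀ X : DerivedCategory (ModuleCat A),
    ∃ h : jS.obj (jStar.obj X) ⟶ (iS.obj (iShriek.obj X))⟦(1 : ℤ)⟧,
      Triangle.mk (adj₂.counit.app X) (adj₄.unit.app X) h ∈ distTriang _

section SplitTorsionPairs

variable {T : Type*} [Category* T] [Preadditive T] [HasZeroObject T] [HasShift T ℤ]
  [∀ n : ℤ, (shiftFunctor T n).Additive] [Pretriangulated T]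

section Exactness

variable {X₁ X₂ X₃ : T} {f : X₁ ⟶ X₂} {g : X₂ ⟶ X₃} {δ : X₃ ⟶ X₁⟦(1 : ℤ)⟧}
  (hT : Triangle.mk f g δ ∈ distTriang T)
include hT

lemma distTriang_lift₁ {Z : T} (u : Z ⟶ X₂) (hu : u ≫ g = 0) : ∃ v : Z ⟶ X₁, v ≫ f = u :=
  let ⟨v, hv⟩ := Triangle.coyoneda_exact₂ _ hT u hu
  ⟨v, hv.symm⟩

lemma distTriang_lift₂ {Z : T} (u : Z ⟶ X₃) (hu : u ≫ δ = 0) : ∃ v : Z ⟶ X₂, v ≫ g = u :=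
  let ⟨v, hv⟩ := Triangle.coyoneda_exact₃ _ hT u hu
  ⟨v, hv.symm⟩

lemma distTriang_lift₃ {Z : T} (u : Z ⟶ X₁⟦(1 : ℤ)⟧) (hu : u ≫ f⟦(1 : ℤ)⟧' = 0) :
    ∃ v : Z ⟶ X₃, v ≫ δ = u :=
  let ⟨v, hv⟩ := Triangle.coyoneda_exact₁ _ hT u hu
  ⟨v, hv.symm⟩

lemma distTriang_desc₂ {Z : T} (u : X₁ ⟶ Z) (hu : δ ≫ u⟦(1 : ℤ)⟧' = 0) :
    ∃ v : X₂ ⟶ Z, f ≫ v = u := by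
  obtain ⟨w, hw⟩ : ∃ w : X₂⟦(1 : ℤ)⟧ ⟶ Z⟦(1 : ℤ)⟧, u⟦(1 : ℤ)⟧' = (-f⟦(1 : ℤ)⟧') ≫ w :=
    Triangle.yoneda_exact₂ _ (rot_of_distTriang _ (rot_of_distTriang _ hT)) (u⟦(1 : ℤ)⟧') hu
  obtain ⟨v, rfl⟩ := (shiftFunctor T (1 : ℤ)).map_surjective w
  refine ⟨-v, (shiftFunctor T (1 : ℤ)).map_injective ?_⟩
  rw [hw, Preadditive.comp_neg, Functor.map_neg, Functor.map_comp, Preadditive.neg_comp]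

lemma distTriang_desc₃ {Z : T} (u : X₂ ⟶ Z) (hu : f ≫ u = 0) : ∃ v : X₃ ⟶ Z, g ≫ v = u :=
  let ⟨v, hv⟩ := Triangle.yoneda_exact₂ _ hT u hu
  ⟨v, hv.symm⟩

lemma distTriang_desc₁ {Z : T} (u : X₃ ⟶ Z) (hu : g ≫ u = 0) :
    ∃ v : X₁⟦(1 : ℤ)⟧ ⟶ Z, δ ≫ v = u :=
  let ⟨v, hv⟩ := Triangle.yoneda_exact₃ _ hT u hu
  ⟨v, hv.symm⟩

end Exactness

/-- A torsion pair `(P, Q)` in a pretriangulated category (not assumed stable under shifts) whose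
canonical triangles come from a coreflection and a reflection, such that every morphism of `P` is
a weak cokernel in `P` and every epimorphism of `Q` splits. -/
structure ReflectiveTorsionPair (P Q : ObjectProperty T) : Prop where
  hom_eq_zero : ∀ {X Y : T}, P X → Q Y → ∀ f : X ⟶ Y, f = 0
  left_of : ∀ {X : T}, (∀ (Y : T), Q Y → ∀ f : X ⟶ Y, f = 0) → P X
  right_of : ∀ {Y : T}, (∀ (X : T), P X → ∀ f : X ⟶ Y, f = 0) → Q Y
  exists_triangle : ∀ X : T, ∃ (U V : T) (a : U ⟶ X) (b : X ⟶ V) (c : V ⟶ U⟦(1 : ℤ)⟧),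
    P U ∧ Q V ∧ Triangle.mk a b c ∈ distTriang T ∧
    (∀ {U' : T}, P U' → ∀ f : U' ⟶ U, f ≫ a = 0 → f = 0) ∧
    (∀ {V' : T}, Q V' → ∀ f : V ⟶ V', b ≫ f = 0 → f = 0)
  exists_weakKernel : ∀ {K L : T}, P K → P L → ∀ f : K ⟶ L, ∃ (Z : T) (k : Z ⟶ K), P Z ∧
    k ≫ f = 0 ∧ ∀ {Y : T}, P Y → ∀ w : K ⟶ Y, k ≫ w = 0 → ∃ t : L ⟶ Y, w = f ≫ t
  split_epi : ∀ {X Y : T}, Q X → Q Y → ∀ g : X ⟶ Y,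
    (∀ (Z : T), Q Z → ∀ v : Y ⟶ Z, g ≫ v = 0 → v = 0) → ∃ s : Y ⟶ X, s ≫ g = 𝟙 Y

/-- The cone of a split monomorphism is a complementary summand. -/
lemma exists_complement {K Y : T} (q : K ⟶ Y) (p : Y ⟶ K) (hqp : q ≫ p = 𝟙 K) :
    ∃ (L : T) (j : L ⟶ Y) (s : Y ⟶ L), j ≫ s = 𝟙 L ∧ j ≫ p = 0 ∧ q ≫ s = 0 ∧
      p ≫ q + s ≫ j = 𝟙 Y := by
  obtain ⟨L, s, δ, hT⟩ := distinguished_cocone_triangle q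
  have hqs : q ≫ s = 0 := comp_distTriang_mor_zero₁₂ _ hT
  have hδ : δ = 0 := by
    have h : δ ≫ q⟦(1 : ℤ)⟧' = 0 := comp_distTriang_mor_zero₃₁ _ hT
    have h2 := h =≫ p⟦(1 : ℤ)⟧'
    rwa [Category.assoc, ← Functor.map_comp, hqp, CategoryTheory.Functor.map_id, Category.comp_id,
      zero_comp] at h2
  obtain ⟨j₀, hj₀⟩ := distTriang_lift₂ hT (𝟙 L) (by rw [hδ, comp_zero])
  have hjs : (j₀ - j₀ ≫ p ≫ q) ≫ s = 𝟙 L := by simp [Preadditive.sub_comp, hj₀, hqs]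
  have hjp : (j₀ - j₀ ≫ p ≫ q) ≫ p = 0 := by simp [Preadditive.sub_comp, hqp]
  generalize j₀ - j₀ ≫ p ≫ q = j at hjs hjp
  refine ⟨L, j, s, hjs, hjp, hqs, ?_⟩
  obtain ⟨t, ht⟩ := distTriang_lift₁ hT (𝟙 Y - p ≫ q - s ≫ j)
    (by simp [Preadditive.sub_comp, hqs, hjs])
  have h0 : t = 0 := by
    have h : (𝟙 Y - p ≫ q - s ≫ j) ≫ p = t := by rw [← ht, Category.assoc, hqp, Category.comp_id]
    rw [← h]
    simp [Preadditive.sub_comp, hqp, hjp]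
  rw [h0, zero_comp, sub_sub, eq_comm, sub_eq_zero] at ht
  exact ht.symm

namespace ReflectiveTorsionPair

variable {P Q : ObjectProperty T} (h : ReflectiveTorsionPair P Q)
include h

lemma left_of_retract {X Y : T} (hY : P Y) (i : X ⟶ Y) (r : Y ⟶ X) (hir : i ≫ r = 𝟙 X) :
    P X := by
  refine h.left_of fun Z hZ f => ?_
  rw [← Category.id_comp f, ← hir, Category.assoc, h.hom_eq_zero hY hZ (r ≫ f), comp_zero]

lemma right_of_iso {X Y : T} (hY : Q Y) (e : X ≅ Y) : Q X := by
  refine h.right_of fun Z hZ f => ?_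
  rw [← cancel_mono e.hom, h.hom_eq_zero hZ hY (f ≫ e.hom), zero_comp]

/-- Each object of `P` splits as `K ⊕ L` with `K⟦1⟧` in `Q` and `L⟦1⟧` in `P`. -/
lemma exists_splitting {Y : T} (hY : P Y) :
    ∃ (K L : T) (q : K ⟶ Y) (p : Y ⟶ K) (j : L ⟶ Y) (s : Y ⟶ L),
      q ≫ p = 𝟙 K ∧ j ≫ s = 𝟙 L ∧ p ≫ q + s ≫ j = 𝟙 Y ∧
      P K ∧ Q (K⟦(1 : ℤ)⟧) ∧ P L ∧ P (L⟦(1 : ℤ)⟧) := by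
  obtain ⟨U, V, a, b, c, hU, hV, hT, ha, -⟩ := h.exists_triangle (Y⟦(1 : ℤ)⟧)
  obtain ⟨D, η, θ, hD⟩ := distinguished_cocone_triangle₂ a
  have hD' : Triangle.mk a (-η⟦(1 : ℤ)⟧') (-θ⟦(1 : ℤ)⟧') ∈ distTriang T :=
    rot_of_distTriang _ (rot_of_distTriang _ hD)
  have hD1 : Q (D⟦(1 : ℤ)⟧) := by
    have e := isoTriangleOfIso₁₂ _ _ hD' hT (Iso.refl _) (Iso.refl _)
      ((Category.comp_id a).trans (Category.id_comp a).symm)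
    exact h.right_of_iso hV (Triangle.π₃.mapIso e)
  obtain ⟨K, V', κ, κ', δ, hK, hV', hκ, huniq, -⟩ := h.exists_triangle D
  obtain ⟨p, hp⟩ := distTriang_lift₁ hκ η (h.hom_eq_zero hY hV' _)
  have hκθ : κ ≫ θ = 0 := by
    apply ha hK
    rw [Category.assoc]
    have : θ ≫ a = 0 := comp_distTriang_mor_zero₂₃ _ hD
    rw [this, comp_zero]
  obtain ⟨q, hq⟩ := distTriang_lift₁ hD κ hκθ
  have hqp : q ≫ p = 𝟙 K := by
    rw [← sub_eq_zero]
    apply huniq hK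
    rw [Preadditive.sub_comp, Category.assoc, hp, hq, Category.id_comp, sub_self]
  obtain ⟨L, j, s, hjs, hjp, -, hadd⟩ := exists_complement q p hqp
  refine ⟨K, L, q, p, j, s, hqp, hjs, hadd, hK, ?_, h.left_of_retract hY j s hjs, ?_⟩
  · refine h.right_of fun Z hZ u => ?_
    obtain ⟨u', hu'⟩ := distTriang_lift₃ hκ u (h.hom_eq_zero hZ hD1 _)
    rw [← hu', h.hom_eq_zero hZ hV' u', zero_comp]
  · refine h.left_of fun Z hZ v => ?_
    obtain ⟨w, hw⟩ := distTriang_desc₃ hD' (s⟦(1 : ℤ)⟧' ≫ v) (h.hom_eq_zero hU hZ _)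
    have hjη : j ≫ η = 0 := by rw [← hp, ← Category.assoc, hjp, zero_comp]
    calc v = j⟦(1 : ℤ)⟧' ≫ s⟦(1 : ℤ)⟧' ≫ v := by
          rw [← Category.assoc, ← Functor.map_comp, hjs, CategoryTheory.Functor.map_id,
            Category.id_comp]
      _ = 0 := by
          rw [← hw, ← Category.assoc, Preadditive.comp_neg, ← Functor.map_comp, hjη,
            Functor.map_zero, neg_zero, zero_comp]

lemma hom_eq_zero_of_shift {K L : T} (hK : P K) (hK' : Q (K⟦(1 : ℤ)⟧)) (hL : P L)
    (hL' : P (L⟦(1 : ℤ)⟧)) (f : K ⟶ L) : f = 0 := by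
  have hLK {Y Z : T} (hY : P (Y⟦(1 : ℤ)⟧)) (hZ : Q (Z⟦(1 : ℤ)⟧)) (g : Y ⟶ Z) : g = 0 :=
    (shiftFunctor T (1 : ℤ)).map_injective
      ((h.hom_eq_zero hY hZ _).trans ((shiftFunctor T (1 : ℤ)).map_zero _ _).symm)
  obtain ⟨Z, k, hZ, hkf, hfac⟩ := h.exists_weakKernel hK hL f
  obtain ⟨Z₁, Z₂, q, p, j, s, -, -, hadd, hZ₁, hZ₁', -, hZ₂'⟩ := h.exists_splitting hZ
  have hk : k = p ≫ q ≫ k := by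
    calc k = (p ≫ q + s ≫ j) ≫ k := by rw [hadd, Category.id_comp]
      _ = p ≫ q ≫ k := by
        rw [Preadditive.add_comp, Category.assoc, Category.assoc, hLK hZ₂' hK' (j ≫ k),
          comp_zero, add_zero]
  obtain ⟨σ, hσ⟩ := h.split_epi hZ₁' hK' ((q ≫ k)⟦(1 : ℤ)⟧') (by
    intro W hW v hv
    let e := (shiftFunctor T (1 : ℤ)).objObjPreimageIso W
    obtain ⟨v', hv'⟩ := (shiftFunctor T (1 : ℤ)).map_surjective (v ≫ e.inv)
    have hkv : (q ≫ k) ≫ v' = 0 := (shiftFunctor T (1 : ℤ)).map_injective (by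
      rw [Functor.map_comp, hv', ← Category.assoc, hv, zero_comp, Functor.map_zero])
    obtain ⟨K', V', κ, κ', δ, hK₁, hV', hκ, huniq, -⟩ :=
      h.exists_triangle ((shiftFunctor T (1 : ℤ)).objPreimage W)
    obtain ⟨w, rfl⟩ := distTriang_lift₁ hκ v' (h.hom_eq_zero hK hV' _)
    obtain ⟨t, rfl⟩ := hfac hK₁ w (by
      rw [hk, Category.assoc, huniq hZ₁ ((q ≫ k) ≫ w) (by rw [Category.assoc, hkv]), comp_zero])
    have ht : t ≫ κ = 0 := hLK hL' (h.right_of_iso hW e) _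
    rw [Category.assoc, ht, comp_zero, Functor.map_zero] at hv'
    rw [← cancel_mono e.inv, ← hv', zero_comp])
  obtain ⟨σ, rfl⟩ := (shiftFunctor T (1 : ℤ)).map_surjective σ
  have hσ' : σ ≫ q ≫ k = 𝟙 K := (shiftFunctor T (1 : ℤ)).map_injective (by
    rw [Functor.map_comp, hσ, CategoryTheory.Functor.map_id])
  rw [← Category.id_comp f, ← hσ', Category.assoc, Category.assoc, hkf, comp_zero, comp_zero]

/-- Each object `X` has a summand `K₁` in `P`, with `K₁⟦1⟧` in `Q`, through which every morphism to
`X` from an object of this kind factors. -/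
lemma exists_summand (X : T) :
    ∃ (K₁ : T) (ι : K₁ ⟶ X) (ρ : X ⟶ K₁), P K₁ ∧ Q (K₁⟦(1 : ℤ)⟧) ∧ ι ≫ ρ = 𝟙 K₁ ∧
      ∀ {K : T}, P K → Q (K⟦(1 : ℤ)⟧) → ∀ f : K ⟶ X, ∃ f' : K ⟶ K₁, f' ≫ ι = f := by
  obtain ⟨U, V, a, b, c, hU, hV, hT, -, hb⟩ := h.exists_triangle X
  obtain ⟨K₁, L₁, q, p, j, s, hqp, -, hadd, hK₁, hK₁', hL₁, hL₁'⟩ := h.exists_splitting hU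
  have hbc : b ≫ c = 0 := comp_distTriang_mor_zero₂₃ _ hT
  obtain ⟨ρ, hρ⟩ := distTriang_desc₂ hT p
    (hb hK₁' _ (by rw [← Category.assoc, hbc, zero_comp]))
  refine ⟨K₁, q ≫ a, ρ, hK₁, hK₁', by rw [Category.assoc, hρ, hqp], ?_⟩
  intro K hK hK' f
  obtain ⟨f', rfl⟩ := distTriang_lift₁ hT f (h.hom_eq_zero hK hV _)
  refine ⟨f' ≫ p, ?_⟩
  have hs : f' ≫ s = 0 := h.hom_eq_zero_of_shift hK hK' hL₁ hL₁' _
  calc (f' ≫ p) ≫ q ≫ a = (f' ≫ (p ≫ q + s ≫ j)) ≫ a := by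
        rw [Preadditive.comp_add, ← Category.assoc f' s, hs, zero_comp, add_zero]
        simp only [Category.assoc]
    _ = f' ≫ a := by rw [hadd, Category.comp_id]

/-- Morphisms out of an object `K` of `P` with `K⟦1⟧` in `Q` are von Neumann regular. -/
lemma exists_regular_of_source {K X : T} (hK : P K) (hK' : Q (K⟦(1 : ℤ)⟧)) (f : K ⟶ X) :
    ∃ g : X ⟶ K, f ≫ g ≫ f = f := by
  obtain ⟨K₂, ι₂, ρ₂, hK₂, hK₂', hιρ₂, hfac₂⟩ := h.exists_summand X
  obtain ⟨f, rfl⟩ := hfac₂ hK hK' f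
  obtain ⟨G, γ, ε, hT⟩ := distinguished_cocone_triangle f
  obtain ⟨K₁, ι, ρ, hK₁, hK₁', hιρ, hfac⟩ := h.exists_summand G
  obtain ⟨a, ha⟩ := hfac hK₂ hK₂' γ
  obtain ⟨b, hb⟩ := distTriang_lift₂ hT ι (h.hom_eq_zero hK₁ hK' _)
  obtain ⟨s, hs⟩ := distTriang_lift₁ hT (𝟙 K₂ - a ≫ b) (by
    rw [Preadditive.sub_comp, Category.assoc, hb, ha, Category.id_comp, sub_self])
  have hfa : f ≫ a = 0 := by
    have hfγ : f ≫ γ = 0 := comp_distTriang_mor_zero₁₂ _ hT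
    calc f ≫ a = f ≫ (a ≫ ι) ≫ ρ := by rw [Category.assoc, hιρ, Category.comp_id]
      _ = 0 := by rw [ha, ← Category.assoc, hfγ, zero_comp]
  refine ⟨ρ₂ ≫ s, ?_⟩
  calc (f ≫ ι₂) ≫ (ρ₂ ≫ s) ≫ f ≫ ι₂ = f ≫ (ι₂ ≫ ρ₂) ≫ (s ≫ f) ≫ ι₂ := by
        simp only [Category.assoc]
    _ = f ≫ ι₂ := by
      rw [hιρ₂, hs, Category.id_comp, Preadditive.sub_comp, Preadditive.comp_sub,
        Category.id_comp, Category.assoc, ← Category.assoc f a, hfa, zero_comp, sub_zero]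

/-- Morphisms into an object `K` of `P` with `K⟦1⟧` in `Q` are von Neumann regular. -/
lemma exists_regular_of_target {K X : T} (hK : P K) (hK' : Q (K⟦(1 : ℤ)⟧)) (f : X ⟶ K) :
    ∃ g : K ⟶ X, f ≫ g ≫ f = f := by
  obtain ⟨G, γ, ε, hT⟩ := distinguished_cocone_triangle f
  obtain ⟨s, hs⟩ := h.exists_regular_of_source hK hK' γ
  obtain ⟨t, ht⟩ := distTriang_lift₁ hT (𝟙 K - γ ≫ s) (by
    rw [Preadditive.sub_comp, Category.assoc, hs, Category.id_comp, sub_self])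
  have hfγ : f ≫ γ = 0 := comp_distTriang_mor_zero₁₂ _ hT
  exact ⟨t, by rw [ht, Preadditive.comp_sub, Category.comp_id, ← Category.assoc, hfγ,
    zero_comp, sub_zero]⟩

end ReflectiveTorsionPair

end SplitTorsionPairs

section Orthogonality

variable {T : Type*} [Category* T] [Preadditive T] [HasShift T ℤ]
  [∀ n : ℤ, (shiftFunctor T n).Additive]

lemma shift_hom_eq_zero {X Y : T} (hXY : ∀ f : X ⟶ Y, f = 0) (n : ℤ) (f : X⟦n⟧ ⟶ Y⟦n⟧) :
    f = 0 := by
  obtain ⟨f, rfl⟩ := (shiftFunctor T n).map_surjective f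
  rw [hXY f, Functor.map_zero]

lemma hom_eq_zero_of_shift_hom_eq_zero {X Y : T} (n : ℤ) (hXY : ∀ f : X⟦n⟧ ⟶ Y⟦n⟧, f = 0)
    (f : X ⟶ Y) : f = 0 :=
  (shiftFunctor T n).map_injective ((hXY _).trans ((shiftFunctor T n).map_zero _ _).symm)

lemma eq_zero_of_comp_shift_map {X A : T} {α : X ⟶ A} (hα : ∀ θ : X ⟶ X, θ ≫ α = 0 → θ = 0)
    (n : ℤ) (θ : X⟦n⟧ ⟶ X⟦n⟧) (hθ : θ ≫ α⟦n⟧' = 0) : θ = 0 := by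
  obtain ⟨θ, rfl⟩ := (shiftFunctor T n).map_surjective θ
  rw [hα θ ((shiftFunctor T n).map_injective (by rw [Functor.map_comp, hθ, Functor.map_zero])),
    Functor.map_zero]

lemma eq_zero_of_shift_map_comp {A M : T} {β : A ⟶ M} (hβ : ∀ θ : M ⟶ M, β ≫ θ = 0 → θ = 0)
    (n : ℤ) (θ : M⟦n⟧ ⟶ M⟦n⟧) (hθ : β⟦n⟧' ≫ θ = 0) : θ = 0 := by
  obtain ⟨θ, rfl⟩ := (shiftFunctor T n).map_surjective θ
  rw [hβ θ ((shiftFunctor T n).map_injective (by rw [Functor.map_comp, hθ, Functor.map_zero])),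
    Functor.map_zero]

/-- Two morphisms `α : X ⟶ A` and `β : A ⟶ M`, respectively right and left cancellable against
endomorphisms, with no nonzero morphism `X ⟶ M`, such that `A` has no nonzero morphisms between
distinct shifts. -/
structure OrthogonalFactors {X A M : T} (α : X ⟶ A) (β : A ⟶ M) : Prop where
  eq_zero_of_comp : ∀ θ : X ⟶ X, θ ≫ α = 0 → θ = 0
  eq_zero_of_comp' : ∀ θ : M ⟶ M, β ≫ θ = 0 → θ = 0
  hom_eq_zero : ∀ f : X ⟶ M, f = 0
  shift_hom_eq_zero : ∀ m p : ℤ, m ≠ p → ∀ f : A⟦m⟧ ⟶ A⟦p⟧, f = 0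

namespace OrthogonalFactors

variable {X A M : T} {α : X ⟶ A} {β : A ⟶ M} (H : OrthogonalFactors α β)
include H

lemma hom_retract_eq_zero {S : T} (hS : ∀ {Y : T} (f : S ⟶ Y), ∃ g : Y ⟶ S, f ≫ g ≫ f = f)
    {m p : ℤ} (i : S ⟶ X⟦m⟧) (r : X⟦m⟧ ⟶ S) (hir : i ≫ r = 𝟙 S) (f : S ⟶ M⟦p⟧) : f = 0 := by
  obtain rfl | hmp := eq_or_ne m p
  · rw [← Category.id_comp f, ← hir, Category.assoc,
      _root_.shift_hom_eq_zero H.hom_eq_zero m (r ≫ f), comp_zero]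
  obtain ⟨t, ht⟩ := hS (i ≫ α⟦m⟧')
  have h1 : (i ≫ α⟦m⟧') ≫ t = 𝟙 S := by
    have h0 : r ≫ (𝟙 S - (i ≫ α⟦m⟧') ≫ t) ≫ i = 0 := by
      refine eq_zero_of_comp_shift_map H.eq_zero_of_comp m _ ?_
      simp only [Category.assoc] at ht
      simp only [Category.assoc, Preadditive.sub_comp, Preadditive.comp_sub, Category.id_comp, ht,
        sub_self]
    have h2 : i ≫ (r ≫ (𝟙 S - (i ≫ α⟦m⟧') ≫ t) ≫ i) ≫ r = 0 := by
      rw [h0, zero_comp, comp_zero]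
    have h3 : (i ≫ r) ≫ (𝟙 S - (i ≫ α⟦m⟧') ≫ t) ≫ (i ≫ r) = 0 := by
      simpa only [Category.assoc] using h2
    rw [hir, Category.id_comp, Category.comp_id] at h3
    exact (sub_eq_zero.1 h3).symm
  obtain ⟨g, hg⟩ := hS f
  have h2 : β⟦p⟧' ≫ g = 0 := by
    have h0 : (β⟦p⟧' ≫ g) ≫ i ≫ α⟦m⟧' = 0 := by
      simpa only [Category.assoc] using
        H.shift_hom_eq_zero p m hmp.symm (β⟦p⟧' ≫ g ≫ i ≫ α⟦m⟧')
    rw [← Category.comp_id (β⟦p⟧' ≫ g), ← h1, ← Category.assoc, h0, zero_comp]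
  rw [← hg, eq_zero_of_shift_map_comp H.eq_zero_of_comp' p (g ≫ f)
    (by rw [← Category.assoc, h2, zero_comp]), comp_zero]

lemma hom_retract_eq_zero' {S : T} (hS : ∀ {Y : T} (f : Y ⟶ S), ∃ g : S ⟶ Y, f ≫ g ≫ f = f)
    {m p : ℤ} (i : S ⟶ M⟦m⟧) (r : M⟦m⟧ ⟶ S) (hir : i ≫ r = 𝟙 S) (f : X⟦p⟧ ⟶ S) : f = 0 := by
  obtain rfl | hmp := eq_or_ne m p
  · rw [← Category.comp_id f, ← hir, ← Category.assoc,
      _root_.shift_hom_eq_zero H.hom_eq_zero m (f ≫ i), zero_comp]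
  obtain ⟨t, ht⟩ := hS (β⟦m⟧' ≫ r)
  have h1 : t ≫ β⟦m⟧' ≫ r = 𝟙 S := by
    have h0 : r ≫ (𝟙 S - t ≫ β⟦m⟧' ≫ r) ≫ i = 0 := by
      refine eq_zero_of_shift_map_comp H.eq_zero_of_comp' m _ ?_
      have ht' : β⟦m⟧' ≫ r ≫ t ≫ β⟦m⟧' ≫ r ≫ i = β⟦m⟧' ≫ r ≫ i := by
        simpa only [Category.assoc] using ht =≫ i
      simp only [Category.assoc, Preadditive.sub_comp, Preadditive.comp_sub, Category.id_comp, ht',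
        sub_self]
    have h2 : i ≫ (r ≫ (𝟙 S - t ≫ β⟦m⟧' ≫ r) ≫ i) ≫ r = 0 := by
      rw [h0, zero_comp, comp_zero]
    have h3 : (i ≫ r) ≫ (𝟙 S - t ≫ β⟦m⟧' ≫ r) ≫ (i ≫ r) = 0 := by
      simpa only [Category.assoc] using h2
    rw [hir, Category.id_comp, Category.comp_id] at h3
    exact (sub_eq_zero.1 h3).symm
  obtain ⟨g, hg⟩ := hS f
  have h2 : g ≫ α⟦p⟧' = 0 := by
    have h0 : (β⟦m⟧' ≫ r) ≫ g ≫ α⟦p⟧' = 0 := by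
      simpa only [Category.assoc] using
        H.shift_hom_eq_zero m p hmp (β⟦m⟧' ≫ r ≫ g ≫ α⟦p⟧')
    rw [← Category.id_comp (g ≫ α⟦p⟧'), ← h1, Category.assoc, h0, comp_zero]
  rw [← hg, ← Category.assoc, eq_zero_of_comp_shift_map H.eq_zero_of_comp p (f ≫ g)
    (by rw [Category.assoc, h2, comp_zero]), zero_comp]

variable [HasZeroObject T] [Pretriangulated T]

/-- There are no nonzero morphisms from `X` to nonpositive shifts of `M`. -/
lemma hom_shift_neg_eq_zero {P Q : ObjectProperty T} (h : ReflectiveTorsionPair P Q) (hM : Q M)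
    (q : ℕ) {m : ℤ} {L : T} (hL : P L) (i : L ⟶ X⟦m⟧) (r : X⟦m⟧ ⟶ L) (hir : i ≫ r = 𝟙 L)
    (f : L ⟶ M⟦-(q : ℤ)⟧) : f = 0 := by
  induction q generalizing m L with
  | zero =>
    let e : M⟦-((0 : ℕ) : ℤ)⟧ ≅ M := (shiftFunctorZero' T _ (by simp)).app M
    rw [← cancel_mono e.hom, h.hom_eq_zero hL hM (f ≫ e.hom), zero_comp]
  | succ q ih =>
    obtain ⟨K, L', a, b, j, s, hab, hjs, hadd, hK, hK', -, hL'⟩ := h.exists_splitting hL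
    have hK0 : a ≫ f = 0 := H.hom_retract_eq_zero (h.exists_regular_of_source hK hK') (a ≫ i)
      (r ≫ b) (by rw [Category.assoc, ← Category.assoc i, hir, Category.id_comp, hab]) _
    have hL0 : j ≫ f = 0 := by
      refine hom_eq_zero_of_shift_hom_eq_zero 1 (fun φ => ?_) _
      let e : X⟦m + 1⟧ ≅ X⟦m⟧⟦(1 : ℤ)⟧ := (shiftFunctorAdd T m 1).app X
      let e' : M⟦-((q + 1 : ℕ) : ℤ)⟧⟦(1 : ℤ)⟧ ≅ M⟦-(q : ℤ)⟧ :=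
        ((shiftFunctorAdd' T (-((q + 1 : ℕ) : ℤ)) 1 (-(q : ℤ)) (by push_cast; ring)).app M).symm
      rw [← cancel_mono e'.hom, zero_comp]
      refine ih hL' ((j ≫ i)⟦(1 : ℤ)⟧' ≫ e.inv) (e.hom ≫ (r ≫ s)⟦(1 : ℤ)⟧') ?_ _
      rw [Category.assoc, e.inv_hom_id_assoc, ← Functor.map_comp, Category.assoc,
        ← Category.assoc i, hir, Category.id_comp, hjs, CategoryTheory.Functor.map_id]
    rw [← Category.id_comp f, ← hadd, Preadditive.add_comp, Category.assoc, Category.assoc, hK0,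
      hL0, comp_zero, comp_zero, add_zero]

/-- There are no nonzero morphisms from nonpositive shifts of `X` to `M`. -/
lemma shift_neg_hom_eq_zero {P Q : ObjectProperty T} (h : ReflectiveTorsionPair P Q)
    (hXP : ∀ {Y : T}, P Y → ∀ f : X ⟶ Y, f = 0)
    (q : ℕ) {m : ℤ} {N : T} (hN : P N) (i : N ⟶ M⟦m⟧) (r : M⟦m⟧ ⟶ N) (hir : i ≫ r = 𝟙 N)
    (f : X⟦-(q : ℤ)⟧ ⟶ N) : f = 0 := by
  induction q generalizing m N with
  | zero =>
    let e : X⟦-((0 : ℕ) : ℤ)⟧ ≅ X := (shiftFunctorZero' T _ (by simp)).app X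
    rw [← cancel_epi e.inv, hXP hN (e.inv ≫ f), comp_zero]
  | succ q ih =>
    obtain ⟨K, L, a, b, j, s, hab, hjs, hadd, hK, hK', -, hL'⟩ := h.exists_splitting hN
    have hK0 : f ≫ b = 0 := H.hom_retract_eq_zero' (h.exists_regular_of_target hK hK') (a ≫ i)
      (r ≫ b) (by rw [Category.assoc, ← Category.assoc i, hir, Category.id_comp, hab]) _
    have hL0 : f ≫ s = 0 := by
      refine hom_eq_zero_of_shift_hom_eq_zero 1 (fun φ => ?_) _
      let e : M⟦m + 1⟧ ≅ M⟦m⟧⟦(1 : ℤ)⟧ := (shiftFunctorAdd T m 1).app M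
      let e' : X⟦-((q + 1 : ℕ) : ℤ)⟧⟦(1 : ℤ)⟧ ≅ X⟦-(q : ℤ)⟧ :=
        ((shiftFunctorAdd' T (-((q + 1 : ℕ) : ℤ)) 1 (-(q : ℤ)) (by push_cast; ring)).app X).symm
      rw [← cancel_epi e'.inv, comp_zero]
      refine ih hL' ((j ≫ i)⟦(1 : ℤ)⟧' ≫ e.inv) (e.hom ≫ (r ≫ s)⟦(1 : ℤ)⟧') ?_ _
      rw [Category.assoc, e.inv_hom_id_assoc, ← Functor.map_comp, Category.assoc,
        ← Category.assoc i, hir, Category.id_comp, hjs, CategoryTheory.Functor.map_id]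
    rw [← Category.comp_id f, ← hadd, Preadditive.comp_add, ← Category.assoc, ← Category.assoc, hK0,
      hL0, zero_comp, zero_comp, add_zero]

/-- For adjacent reflective torsion pairs `(P₁, P₂)` and `(P₂, P₃)` with `X` in `P₁` and `M` in `P₂`,
there are no nonzero morphisms from `X` to any shift of `M`. -/
theorem hom_shift_eq_zero {P₁ P₂ P₃ : ObjectProperty T} (h : ReflectiveTorsionPair P₁ P₂)
    (h' : ReflectiveTorsionPair P₂ P₃) (hX : P₁ X) (hM : P₂ M) (n : ℤ) (f : X ⟶ M⟦n⟧) :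
    f = 0 := by
  let eX : X⟦(0 : ℤ)⟧ ≅ X := (shiftFunctorZero T ℤ).app X
  let eM : M⟦(0 : ℤ)⟧ ≅ M := (shiftFunctorZero T ℤ).app M
  obtain ⟨q, rfl | rfl⟩ := n.eq_nat_or_neg
  · refine hom_eq_zero_of_shift_hom_eq_zero (-(q : ℤ)) (fun φ => ?_) f
    let e := (shiftFunctorCompIsoId T (q : ℤ) (-(q : ℤ)) (by simp)).app M
    rw [← cancel_mono e.hom, zero_comp]
    exact H.shift_neg_hom_eq_zero h' (fun hY => h.hom_eq_zero hX hY) q hM eM.inv eM.hom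
      eM.inv_hom_id _
  · exact H.hom_shift_neg_eq_zero h hM q hX eX.inv eX.hom eX.inv_hom_id f

end OrthogonalFactors

variable [HasZeroObject T] [Pretriangulated T] in
/-- If no nonzero morphism exists from the first object of a distinguished triangle to a shift of
the third, then precomposition with the second morphism is bijective. -/
lemma bijective_comp_of_distTriang {X A M : T} {α : X ⟶ A} {β : A ⟶ M} {δ : M ⟶ X⟦(1 : ℤ)⟧}
    (hT : Triangle.mk α β δ ∈ distTriang T) (hXM : ∀ (n : ℤ) (f : X ⟶ M⟦n⟧), f = 0) (n : ℤ) :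
    Function.Bijective (fun f : M ⟶ M⟦n⟧ => β ≫ f) := by
  refine ⟨fun f g hfg => ?_, fun u => distTriang_desc₃ hT u (hXM n _)⟩
  rw [← sub_eq_zero]
  obtain ⟨v, hv⟩ := distTriang_desc₁ hT (f - g)
    (by rw [Preadditive.comp_sub]; exact sub_eq_zero.2 hfg)
  let e : M⟦n⟧ ≅ M⟦n - 1⟧⟦(1 : ℤ)⟧ := (shiftFunctorAdd' T (n - 1) 1 n (by ring)).app M
  have hv0 : v = 0 := by
    rw [← cancel_mono e.hom, zero_comp, shift_hom_eq_zero (hXM (n - 1)) 1 (v ≫ e.hom)]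
  rw [← hv, hv0, comp_zero]

end Orthogonality

section Adjunctions

universe v₁ v₂ v₃ u₁ u₂ u₃

variable {T : Type u₁} [Category.{v₁} T] [Preadditive T] {U : Type u₂} [Category.{v₂} U]
  [Preadditive U] {V : Type u₃} [Category.{v₃} V] [Preadditive V]

lemma eq_zero_of_comp_counit {F : U ⥤ T} {G : T ⥤ U} (adj : F ⊣ G) [F.Full] {X Y : T}
    (hY : F.essImage Y) (f : Y ⟶ F.obj (G.obj X)) (hf : f ≫ adj.counit.app X = 0) : f = 0 := by
  have := adj.isLeftAdjoint
  have := F.preservesZeroMorphisms_of_isLeftAdjoint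
  obtain ⟨Z, ⟨e⟩⟩ := hY
  obtain ⟨g, hg⟩ := F.map_surjective (e.hom ≫ f)
  have hg0 : g = 0 := (adj.homEquiv _ _).symm.injective (by
    rw [adj.homEquiv_counit, adj.homEquiv_counit, hg, Category.assoc, hf, comp_zero, F.map_zero,
      zero_comp])
  rw [← cancel_epi e.hom, ← hg, hg0, F.map_zero, comp_zero]

lemma eq_zero_of_unit_comp {H : T ⥤ V} {I : V ⥤ T} (adj : H ⊣ I) [I.Full] {X Y : T}
    (hY : I.essImage Y) (f : I.obj (H.obj X) ⟶ Y) (hf : adj.unit.app X ≫ f = 0) : f = 0 := by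
  have := adj.isRightAdjoint
  have := I.preservesZeroMorphisms_of_isRightAdjoint
  obtain ⟨Z, ⟨e⟩⟩ := hY
  obtain ⟨g, hg⟩ := I.map_surjective (f ≫ e.inv)
  have hg0 : g = 0 := (adj.homEquiv _ _).injective (by
    rw [adj.homEquiv_unit, adj.homEquiv_unit, hg, ← Category.assoc, hf, zero_comp, I.map_zero,
      comp_zero])
  rw [← cancel_mono e.inv, ← hg, hg0, I.map_zero, zero_comp]

variable [HasZeroObject T] [HasShift T ℤ] [∀ n : ℤ, (shiftFunctor T n).Additive] [Pretriangulated T]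
  [HasZeroObject U] [HasShift U ℤ] [∀ n : ℤ, (shiftFunctor U n).Additive] [Pretriangulated U]
  [HasZeroObject V] [HasShift V ℤ] [∀ n : ℤ, (shiftFunctor V n).Additive] [Pretriangulated V]

/-- A coreflective and a reflective subcategory which are orthogonal and whose counit and unit fit
into distinguished triangles form a reflective torsion pair. -/
theorem reflectiveTorsionPair_essImage {F : U ⥤ T} {G : T ⥤ U} {H : T ⥤ V} {I : V ⥤ T}
    (adj : F ⊣ G) (adj' : H ⊣ I) [F.Full] [F.Faithful] [I.Full] [I.Faithful]
    (h0 : ∀ (X : U) (Y : V) (f : F.obj X ⟶ I.obj Y), f = 0)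
    (hT : ∀ X : T, ∃ δ : I.obj (H.obj X) ⟶ (F.obj (G.obj X))⟦(1 : ℤ)⟧,
      Triangle.mk (adj.counit.app X) (adj'.unit.app X) δ ∈ distTriang T) :
    ReflectiveTorsionPair F.essImage I.essImage where
  hom_eq_zero := by
    rintro X Y ⟨X', ⟨e⟩⟩ ⟨Y', ⟨e'⟩⟩ f
    rw [← cancel_mono e'.inv, ← cancel_epi e.hom, h0 X' Y' (e.hom ≫ f ≫ e'.inv), zero_comp,
      comp_zero]
  left_of := by
    intro X hX
    obtain ⟨δ, hδ⟩ := hT X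
    have hz : IsZero (I.obj (H.obj X)) := (IsZero.iff_id_eq_zero _).2
      (eq_zero_of_unit_comp adj' (I.obj_mem_essImage _) _
        (by rw [hX _ (I.obj_mem_essImage _) (adj'.unit.app X), zero_comp]))
    have : IsIso (adj.counit.app X) := (Triangle.isZero₃_iff_isIso₁ _ hδ).1 hz
    exact ⟨_, ⟨asIso (adj.counit.app X)⟩⟩
  right_of := by
    intro Y hY
    obtain ⟨δ, hδ⟩ := hT Y
    have hz : IsZero (F.obj (G.obj Y)) := (IsZero.iff_id_eq_zero _).2
      (eq_zero_of_comp_counit adj (F.obj_mem_essImage _) _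
        (by rw [hY _ (F.obj_mem_essImage _) (adj.counit.app Y), comp_zero]))
    have : IsIso (adj'.unit.app Y) := (Triangle.isZero₁_iff_isIso₂ _ hδ).1 hz
    exact ⟨_, ⟨(asIso (adj'.unit.app Y)).symm⟩⟩
  exists_triangle := by
    intro X
    obtain ⟨δ, hδ⟩ := hT X
    refine ⟨_, _, _, _, δ, F.obj_mem_essImage _, I.obj_mem_essImage _, hδ,
      eq_zero_of_comp_counit adj, eq_zero_of_unit_comp adj'⟩
  exists_weakKernel := by
    rintro K L ⟨K', ⟨e⟩⟩ ⟨L', ⟨e'⟩⟩ f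
    have := adj.isLeftAdjoint
    have := F.preservesZeroMorphisms_of_isLeftAdjoint
    obtain ⟨f', hf'⟩ := F.map_surjective (e.hom ≫ f ≫ e'.inv)
    obtain ⟨Z, k, δ, hZ⟩ := distinguished_cocone_triangle₁ f'
    have hkf : k ≫ f' = 0 := comp_distTriang_mor_zero₁₂ _ hZ
    refine ⟨F.obj Z, F.map k ≫ e.hom, F.obj_mem_essImage _, ?_, ?_⟩
    · rw [← cancel_mono e'.inv, zero_comp, Category.assoc, Category.assoc, ← hf', ← F.map_comp,
        hkf, F.map_zero]
    · rintro Y ⟨Y', ⟨d⟩⟩ w hw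
      obtain ⟨w', hw'⟩ := F.map_surjective (e.hom ≫ w ≫ d.inv)
      obtain ⟨t, ht⟩ := distTriang_desc₃ hZ w' (F.map_injective (by
        rw [F.map_comp, hw', F.map_zero, ← Category.assoc, ← Category.assoc, hw, zero_comp]))
      refine ⟨e'.inv ≫ F.map t ≫ d.hom, ?_⟩
      rw [← cancel_mono d.inv, ← cancel_epi e.hom, ← hw', ← ht, F.map_comp, hf']
      simp
  split_epi := by
    rintro X Y ⟨X', ⟨e⟩⟩ ⟨Y', ⟨e'⟩⟩ g hg
    have := adj'.isRightAdjoint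
    have := I.preservesZeroMorphisms_of_isRightAdjoint
    obtain ⟨g', hg'⟩ := I.map_surjective (e.hom ≫ g ≫ e'.inv)
    obtain ⟨Z, c, δ, hZ⟩ := distinguished_cocone_triangle g'
    have hgc : g' ≫ c = 0 := comp_distTriang_mor_zero₁₂ _ hZ
    have hc : c = 0 := I.map_injective (by
      rw [I.map_zero, ← cancel_epi e'.inv, comp_zero]
      refine hg _ (I.obj_mem_essImage _) _ ?_
      rw [← cancel_epi e.hom, comp_zero, ← Category.assoc, ← Category.assoc, Category.assoc e.hom,
        ← hg', ← I.map_comp, hgc, I.map_zero])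
    obtain ⟨s, hs⟩ := distTriang_lift₁ hZ (𝟙 Y') (by rw [hc, comp_zero])
    refine ⟨e'.inv ≫ I.map s ≫ e.hom, ?_⟩
    have h1 : I.map s ≫ e.hom ≫ g ≫ e'.inv = 𝟙 _ := by
      rw [← hg', ← I.map_comp, hs, CategoryTheory.Functor.map_id]
    rw [← cancel_epi e'.hom, ← cancel_mono e'.inv]
    simp [h1]

end Adjunctions

section Stalk

variable {C : Type*} [Category* C] [Abelian C] [HasDerivedCategory C]

lemma singleFunctor_hom_eq_zero_of_projective (P : C) [Projective P] {i j : ℤ} (hij : i ≠ j)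
    (f : (DerivedCategory.singleFunctor C i).obj P ⟶ (DerivedCategory.singleFunctor C j).obj P) :
    f = 0 := by
  obtain hij | hij := hij.lt_or_gt
  · exact DerivedCategory.TStructure.t.zero f i j hij
  · exact DerivedCategory.from_singleFunctor_obj_eq_zero_of_projective
      (L := (CochainComplex.singleFunctor C j).obj P) f j hij

lemma singleFunctor_shift_hom_eq_zero_of_projective (P : C) [Projective P] {m p : ℤ} (hmp : m ≠ p)
    (f : ((DerivedCategory.singleFunctor C 0).obj P)⟦m⟧ ⟶
      ((DerivedCategory.singleFunctor C 0).obj P)⟦p⟧) : f = 0 := by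
  let e (n : ℤ) : ((DerivedCategory.singleFunctor C 0).obj P)⟦n⟧ ≅
      (DerivedCategory.singleFunctor C (-n)).obj P :=
    ((DerivedCategory.singleFunctors C).shiftIso n (-n) 0 (by simp)).app P
  rw [← cancel_epi (e m).inv, ← cancel_mono (e p).hom, comp_zero, zero_comp]
  exact singleFunctor_hom_eq_zero_of_projective P (by simpa using hmp) _

end Stalk

namespace DRecollement

variable {B A C : Type} [Ring B] [Ring A] [Ring C] [HasDerivedCategory (ModuleCat B)]
  [HasDerivedCategory (ModuleCat A)] [HasDerivedCategory (ModuleCat C)] (R : DRecollement B A C)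

lemma jShriek_hom_iS_eq_zero (X : DerivedCategory (ModuleCat C))
    (Y : DerivedCategory (ModuleCat B)) (f : R.jShriek.obj X ⟶ R.iS.obj Y) : f = 0 :=
  (R.adj₃.homEquiv _ _).injective ((R.vanish Y).eq_of_tgt _ _)

lemma iS_hom_jS_eq_zero (X : DerivedCategory (ModuleCat B))
    (Y : DerivedCategory (ModuleCat C)) (f : R.iS.obj X ⟶ R.jS.obj Y) : f = 0 :=
  (R.adj₄.homEquiv _ _).symm.injective ((R.vanish X).eq_of_src _ _)

lemma reflectiveTorsionPair_jShriek_iS :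
    ReflectiveTorsionPair R.jShriek.essImage R.iS.essImage :=
  have := R.jShriek_full
  have := R.jShriek_faithful
  have := R.iS_full
  have := R.iS_faithful
  reflectiveTorsionPair_essImage R.adj₃ R.adj₁ R.jShriek_hom_iS_eq_zero R.tri₁

lemma reflectiveTorsionPair_iS_jS : ReflectiveTorsionPair R.iS.essImage R.jS.essImage :=
  have := R.iS_full
  have := R.iS_faithful
  have := R.jS_full
  have := R.jS_faithful
  reflectiveTorsionPair_essImage R.adj₂ R.adj₄ R.iS_hom_jS_eq_zero R.tri₂

lemma orthogonalFactors_ringObj :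
    OrthogonalFactors (R.adj₃.counit.app (ringObj A)) (R.adj₁.unit.app (ringObj A)) where
  eq_zero_of_comp θ hθ :=
    have := R.jShriek_full
    eq_zero_of_comp_counit R.adj₃ (R.jShriek.obj_mem_essImage _) θ hθ
  eq_zero_of_comp' θ hθ :=
    have := R.iS_full
    eq_zero_of_unit_comp R.adj₁ (R.iS.obj_mem_essImage _) θ hθ
  hom_eq_zero := R.jShriek_hom_iS_eq_zero _ _
  shift_hom_eq_zero _ _ hmp f :=
    have : Projective (ModuleCat.of A A) :=
      ModuleCat.projective_of_free (Module.Basis.singleton Unit A)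
    singleFunctor_shift_hom_eq_zero_of_projective (ModuleCat.of A A) hmp f

end DRecollement

/-- in a recollement of `D(Mod A)` by `D(Mod B)` and `D(Mod C)`,
set `M = i_* i^*(A)`. Applying `RHom_A(-, M)` to the canonical triangle
`j_! j^!(A) → A → M → ` yields an isomorphism `M ≅ RHom_A(M, M)`; cohomologically,
for every `n ∈ ℤ` precomposition with the unit `A → M` gives a bijection
`Hom(M, M[n]) ≃ Hom(A, M[n])`. -/
theorem stmt13 {B A C : Type} [Ring B] [Ring A] [Ring C]
    [HasDerivedCategory (ModuleCat B)] [HasDerivedCategory (ModuleCat A)]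
    [HasDerivedCategory (ModuleCat C)] (R : DRecollement B A C) :
    ∀ n : ℤ, Function.Bijective
      (fun f : R.iS.obj (R.iStar.obj (ringObj A)) ⟶
          (R.iS.obj (R.iStar.obj (ringObj A)))⟦n⟧ =>
        R.adj₁.unit.app (ringObj A) ≫ f) :=
  bijective_comp_of_distTriang (R.tri₁ (ringObj A)).choose_spec
    (R.orthogonalFactors_ringObj.hom_shift_eq_zero R.reflectiveTorsionPair_jShriek_iS
      R.reflectiveTorsionPair_iS_jS (R.jShriek.obj_mem_essImage _) (R.iS.obj_mem_essImage _))
end
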